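/- Let A be a normal uniform algebra on a compact Hausdorff space X and let x ∈ X. Suppose A has bounded relative units at a point y ∈ X. Then the uniform algebra A_x = cl(J_x) ⊕ ℂ·1 also has bounded relative units at y. -/

import Mathlib

open WeakDual Topology

set_option synthInstance.maxHeartbeats 400000
set_option maxHeartbeats 1000000
set_option linter.unusedSectionVars false

noncomputable section

variable {X : Type*} [TopologicalSpace X]

/-- A uniform algebra on `X`: a closed point-separating subalgebra of `C(X, ℂ)`
(it automatically contains the constant functions, being a subalgebra). -/
def IsUniformAlgebra (A : Subalgebra ℂ C(X, ℂ)) : Prop :=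
  IsClosed (A : Set C(X, ℂ)) ∧ ∀ x y : X, x ≠ y → ∃ f ∈ A, f x ≠ f y

/-- The character of evaluation at a point `x ∈ X`. -/
def evalChar (A : Subalgebra ℂ C(X, ℂ)) (x : X) : characterSpace ℂ A :=
  ⟨{ toFun := fun f => (f : C(X, ℂ)) x
     map_add' := fun f g => rfl
     map_smul' := fun c f => rfl
     cont := (ContinuousEvalConst.continuous_eval_const x).comp continuous_subtype_val },
   ⟨by
      intro h
      have h1 : ((1 : A) : C(X, ℂ)) x = 0 := DFunLike.congr_fun h 1
      simp at h1,
    fun f g => rfl⟩⟩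

/-- The continuous linear functional on `A` underlying a character,
as an element of the normed dual of `A`. -/
def charDual {A : Type*} [NonUnitalNonAssocSemiring A] [TopologicalSpace A] [Module ℂ A]
    (φ : characterSpace ℂ A) : A →L[ℂ] ℂ := φ.1

/-- The set `J_φ` of elements of `A` whose Gelfand transform vanishes on a
neighborhood of `φ` in the maximal ideal space of `A`. -/
def vanishNearSet (A : Subalgebra ℂ C(X, ℂ)) (φ : characterSpace ℂ A) : Set A :=
  {f | ∃ U ∈ 𝓝 φ, ∀ ψ ∈ U, ψ f = 0}

/-- `A` is normal on `X`: disjoint closed sets are separated by a `0`-`1` valued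
pair of values of some function in `A`. -/
def IsNormalOn (A : Subalgebra ℂ C(X, ℂ)) : Prop :=
  ∀ K₀ K₁ : Set X, IsClosed K₀ → IsClosed K₁ → Disjoint K₀ K₁ →
    ∃ f ∈ A, (∀ x ∈ K₀, f x = 0) ∧ (∀ x ∈ K₁, f x = 1)

/-- `A` is strongly regular at `x`: `J_x` is dense in `M_x`. -/
def StronglyRegularAt (A : Subalgebra ℂ C(X, ℂ)) (x : X) : Prop :=
  {f : A | (f : C(X, ℂ)) x = 0} ⊆ closure (vanishNearSet A (evalChar A x))

/-- `d` is a point derivation sequence of order `n` at `φ`: `d⁰ = φ` and the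
Leibniz identities hold for `1 ≤ k ≤ n` (linearity/continuity of the `d k` is
imposed by the type at which this is used). -/
def IsDerivSeq {A : Type*} [Mul A] (φ : A → ℂ) (n : ℕ∞) (d : ℕ → A → ℂ) : Prop :=
  (∀ f, d 0 f = φ f) ∧
  ∀ k : ℕ, 1 ≤ k → (k : ℕ∞) ≤ n → ∀ f g,
    d k (f * g) = ∑ j ∈ Finset.range (k + 1), d j f * d (k - j) g

variable [CompactSpace X]

/-- `A` has bounded relative units at `x`. -/
def HasBoundedRelativeUnits (A : Subalgebra ℂ C(X, ℂ)) (x : X) : Prop :=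
  ∃ C : ℝ, 0 < C ∧ ∀ K : Set X, IsCompact K → x ∉ K →
    ∃ f : A, f ∈ vanishNearSet A (evalChar A x) ∧
      (∀ y ∈ K, (f : C(X, ℂ)) y = 1) ∧ ‖(f : C(X, ℂ))‖ ≤ C

/-- `x` is a generalized peak point for `A`. -/
def IsGeneralizedPeakPoint (A : Subalgebra ℂ C(X, ℂ)) (x : X) : Prop :=
  ∀ U ∈ 𝓝 x, ∃ f ∈ A, f x = 1 ∧ ‖f‖ = 1 ∧ ∀ y ∉ U, ‖f y‖ < 1

/-- `P` is a Gleason part for `A`: the set of all characters at dual-norm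
distance `< 2` from some fixed character. -/
def IsGleasonPart (A : Subalgebra ℂ C(X, ℂ)) (P : Set (characterSpace ℂ A)) : Prop :=
  ∃ φ : characterSpace ℂ A, P = {ψ | ‖charDual φ - charDual ψ‖ < 2}

/-- The carrier set of Feinstein's algebra `A_x = cl(J_x) ⊕ ℂ·1`. -/
def feinsteinSet (A : Subalgebra ℂ C(X, ℂ)) (x : X) : Set C(X, ℂ) :=
  {h | ∃ g ∈ closure ((fun f : A => (f : C(X, ℂ))) '' vanishNearSet A (evalChar A x)),
    ∃ c : ℂ, h = g + algebraMap ℂ C(X, ℂ) c}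

/-- `A` is regular on `X`: points are separated from disjoint closed sets by functions in `A`. -/
def IsRegularOn (A : Subalgebra ℂ C(X, ℂ)) : Prop :=
  ∀ z : X, ∀ U ∈ 𝓝 z, ∃ h ∈ A, h z = 1 ∧ ∀ w ∉ U, h w = 0

theorem IsNormalOn.isRegularOn [T1Space X] {A : Subalgebra ℂ C(X, ℂ)} (hA : IsNormalOn A) :
    IsRegularOn A := by
  intro z U hU
  obtain ⟨h, hhA, h0, h1⟩ := hA (interior U)ᶜ {z} isOpen_interior.isClosed_compl
    isClosed_singleton
    (Set.disjoint_singleton_right.2 fun hz => hz (mem_interior_iff_mem_nhds.2 hU))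
  exact ⟨h, hhA, h1 z rfl, fun w hw => h0 w fun hw' => hw (interior_subset hw')⟩

theorem continuous_evalChar (A : Subalgebra ℂ C(X, ℂ)) : Continuous (evalChar A) :=
  Continuous.subtype_mk (WeakDual.continuous_of_continuous_eval fun f => map_continuous f.1) _

theorem eventually_eq_zero_of_mem_vanishNearSet {A : Subalgebra ℂ C(X, ℂ)} {z : X} {f : A}
    (hf : f ∈ vanishNearSet A (evalChar A z)) : ∀ᶠ w in 𝓝 z, (f : C(X, ℂ)) w = 0 := by
  obtain ⟨U, hU, hfU⟩ := hf
  filter_upwards [(continuous_evalChar A).continuousAt.preimage_mem_nhds hU] with w hw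
  exact hfU _ hw

/-- In a regular algebra, vanishing near `z` in the space `X` implies vanishing near `z` in
the maximal ideal space. -/
theorem IsRegularOn.mem_vanishNearSet {A : Subalgebra ℂ C(X, ℂ)} (hA : IsRegularOn A) {z : X}
    {f : A} (hf : ∀ᶠ w in 𝓝 z, (f : C(X, ℂ)) w = 0) : f ∈ vanishNearSet A (evalChar A z) := by
  obtain ⟨h, hhA, hz, h0⟩ := hA z _ hf
  have hmul : (⟨h, hhA⟩ : A) * f = 0 := by
    ext w
    by_cases hw : (f : C(X, ℂ)) w = 0
    · simp [hw]
    · simp [h0 w hw]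
  have hcont : Continuous fun ψ : characterSpace ℂ A => ψ (⟨h, hhA⟩ : A) :=
    (WeakDual.eval_continuous (𝕜 := ℂ) (E := A) ⟨h, hhA⟩).comp continuous_subtype_val
  refine ⟨{ψ | ψ (⟨h, hhA⟩ : A) ≠ 0}, (isOpen_ne_fun hcont continuous_const).mem_nhds ?_, ?_⟩
  · change h z ≠ 0
    simp [hz]
  · intro ψ hψ
    have := congrArg ψ hmul
    rw [map_mul, map_zero] at this
    exact (mul_eq_zero.1 this).resolve_left hψ

/-- A function in a regular algebra `A` that is constant near `x` belongs to `A_x`. -/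
theorem IsRegularOn.mem_feinsteinSet {A : Subalgebra ℂ C(X, ℂ)} (hA : IsRegularOn A) {x : X}
    {f : C(X, ℂ)} (hf : f ∈ A) {c : ℂ} (hc : ∀ᶠ w in 𝓝 x, f w = c) : f ∈ feinsteinSet A x := by
  refine ⟨f - algebraMap ℂ C(X, ℂ) c, subset_closure
    ⟨⟨f - algebraMap ℂ C(X, ℂ) c, A.sub_mem hf (A.algebraMap_mem c)⟩,
      hA.mem_vanishNearSet ?_, rfl⟩, c, by simp⟩
  filter_upwards [hc] with w hw
  simp [hw]

/-- If `A` is normal then `A_x` is regular. -/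
theorem IsNormalOn.isRegularOn_feinstein [T2Space X]
    {A : Subalgebra ℂ C(X, ℂ)} (hA : IsNormalOn A) {x : X} {B : Subalgebra ℂ C(X, ℂ)}
    (hB : (B : Set C(X, ℂ)) = feinsteinSet A x) : IsRegularOn B := by
  have hmem {f : C(X, ℂ)} (hf : f ∈ A) {c : ℂ} (hc : ∀ᶠ w in 𝓝 x, f w = c) : f ∈ B := by
    rw [← SetLike.mem_coe, hB]
    exact hA.isRegularOn.mem_feinsteinSet hf hc
  intro z U hU
  obtain rfl | hzx := eq_or_ne z x
  · obtain ⟨V, hV, hVc, hVU⟩ := exists_mem_nhds_isClosed_subset (interior_mem_nhds.2 hU)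
    obtain ⟨h, hhA, h0, h1⟩ := hA (interior U)ᶜ V isOpen_interior.isClosed_compl hVc
      (Set.disjoint_left.2 fun w hw hwV => hw (hVU hwV))
    exact ⟨h, hmem hhA (Filter.mem_of_superset hV h1), h1 z (mem_of_mem_nhds hV),
      fun w hw => h0 w fun hw' => hw (interior_subset hw')⟩
  · obtain ⟨V, hV, W, hW, hVW⟩ := Filter.disjoint_iff.1 (disjoint_nhds_nhds.2 hzx)
    obtain ⟨h, hhA, hz, h0⟩ := hA.isRegularOn z (U ∩ V) (Filter.inter_mem hU hV)
    exact ⟨h, hmem hhA (Filter.mem_of_superset hW fun w hw => h0 w fun hw' =>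
      Set.disjoint_left.1 hVW hw'.2 hw), hz, fun w hw => h0 w fun hw' => hw hw'.1⟩

/-- If a normal uniform algebra `A` has bounded relative units at `y`,
then so does `A_x = cl(J_x) ⊕ ℂ·1`. -/
theorem feinstein_algebra_hasBoundedRelativeUnits
    {X : Type*} [TopologicalSpace X] [CompactSpace X] [T2Space X]
    (A : Subalgebra ℂ C(X, ℂ)) (hA : IsUniformAlgebra A) (hnormal : IsNormalOn A)
    (x y : X) (hy : HasBoundedRelativeUnits A y)
    (B : Subalgebra ℂ C(X, ℂ)) (hB : (B : Set C(X, ℂ)) = feinsteinSet A x) :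
    HasBoundedRelativeUnits B y := by
  have hmem {f : C(X, ℂ)} (hf : f ∈ A) {c : ℂ} (hc : ∀ᶠ w in 𝓝 x, f w = c) : f ∈ B := by
    rw [← SetLike.mem_coe, hB]
    exact hnormal.isRegularOn.mem_feinsteinSet hf hc
  have hBreg : IsRegularOn B := hnormal.isRegularOn_feinstein hB
  obtain ⟨C, hC, hunits⟩ := hy
  refine ⟨C, hC, fun K hK hyK => ?_⟩
  obtain rfl | hyx := eq_or_ne y x
  · obtain ⟨f, hf, hfK, hfC⟩ := hunits K hK hyK
    have hf0 := eventually_eq_zero_of_mem_vanishNearSet hf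
    exact ⟨⟨f, hmem f.2 hf0⟩, hBreg.mem_vanishNearSet hf0, hfK, hfC⟩
  · obtain ⟨V, hV, hVc, hVy⟩ := exists_mem_nhds_isClosed_subset (isOpen_ne.mem_nhds hyx.symm)
    obtain ⟨f, hf, hfK, hfC⟩ := hunits (K ∪ V) (hK.union hVc.isCompact)
      (fun h => h.elim hyK fun h => hVy h rfl)
    have hf0 := eventually_eq_zero_of_mem_vanishNearSet hf
    exact ⟨⟨f, hmem f.2 (Filter.mem_of_superset hV fun w hw => hfK w (Or.inr hw))⟩,
      hBreg.mem_vanishNearSet hf0,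
      fun w hw => hfK w (Or.inl hw), hfC⟩

end
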